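/- Estimates for the smooth component: There exist a constant C, independent of ε₁ and ε₂, and a choice of boundary value v(0) ∈ ℝ² with |v(0)| ≤ C (componentwise), such that the solution v=(v₁,v₂)ᵀ of Lv = f on (0,1) with v(1)=r and that boundary value at 0 satisfies, for all x ∈ [0,1]: |v₁⁽ᵏ⁾(x)| ≤ C and |v₂⁽ᵏ⁾(x)| ≤ C for 0 ≤ k ≤ 2, and |v₁⁽³⁾(x)| ≤ C ε₁⁻¹, |v₂⁽³⁾(x)| ≤ C ε₂⁻¹. -/

import Mathlib

open Set

/-- The second-order equation with coefficients `ε`, `a`, `-b`, coupling `c` and right side `f` on `[0,1]`, with `v` and `w` of class `C³`. -/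
def SolvesOn (ε : ℝ) (a b c f v w : ℝ → ℝ) : Prop :=
  ContDiff ℝ 3 v ∧ ContDiff ℝ 3 w ∧ ∀ x ∈ Icc (0:ℝ) 1,
    ε * deriv (deriv v) x + a x * deriv v x - b x * v x + c x * w x = f x

theorem eqOn_Icc_of_eqOn_Ioo {f g : ℝ → ℝ} (hf : Continuous f) (hg : Continuous g)
    (h : ∀ x ∈ Ioo (0:ℝ) 1, f x = g x) : ∀ x ∈ Icc (0:ℝ) 1, f x = g x := by
  have h' : EqOn f g (closure (Ioo (0:ℝ) 1)) := EqOn.closure h hf hg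
  rw [closure_Ioo (by norm_num)] at h'
  exact h'

theorem ContDiff.regularity_three {v : ℝ → ℝ} (h : ContDiff ℝ 3 v) :
    Differentiable ℝ v ∧ Differentiable ℝ (deriv v) ∧ Differentiable ℝ (deriv (deriv v)) ∧
      Continuous (deriv (deriv (deriv v))) := by
  have h1 : ContDiff ℝ 2 (deriv v) :=
    ((contDiff_succ_iff_deriv (n := 2)).1 (by simpa [two_add_one_eq_three] using h)).2.2
  have h2 : ContDiff ℝ 1 (deriv (deriv v)) :=
    ((contDiff_succ_iff_deriv (n := 1)).1 (by simpa [one_add_one_eq_two] using h1)).2.2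
  exact ⟨h.differentiable (by norm_num), h1.differentiable (by norm_num),
    h2.differentiable (by norm_num), h2.continuous_deriv (by norm_num)⟩

theorem deriv_nonpos_of_isMaxOn {p : ℝ → ℝ} {x₀ : ℝ} (hp : DifferentiableAt ℝ p x₀)
    (hx₀ : x₀ ∈ Icc (0:ℝ) 1) (hx : x₀ < 1) (hm : ∀ x ∈ Icc (0:ℝ) 1, p x ≤ p x₀) :
    deriv p x₀ ≤ 0 := by
  have h := (hasDerivWithinAt_iff_tendsto_slope' (by simp)).1
    (hp.hasDerivAt.hasDerivWithinAt (s := Ioi x₀))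
  refine le_of_tendsto h ?_
  filter_upwards [Ioo_mem_nhdsGT hx] with y hy
  rw [slope_def_field]
  exact div_nonpos_of_nonpos_of_nonneg
    (sub_nonpos.2 (hm y ⟨hx₀.1.trans hy.1.le, hy.2.le⟩)) (sub_nonneg.2 hy.1.le)

theorem deriv_nonneg_of_isMaxOn {p : ℝ → ℝ} {x₀ : ℝ} (hp : DifferentiableAt ℝ p x₀)
    (hx₀ : x₀ ∈ Icc (0:ℝ) 1) (hx : 0 < x₀) (hm : ∀ x ∈ Icc (0:ℝ) 1, p x ≤ p x₀) :
    0 ≤ deriv p x₀ := by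
  have h := (hasDerivWithinAt_iff_tendsto_slope' (by simp)).1
    (hp.hasDerivAt.hasDerivWithinAt (s := Iio x₀))
  refine ge_of_tendsto h ?_
  filter_upwards [Ioo_mem_nhdsLT hx] with y hy
  rw [slope_def_field]
  exact div_nonneg_of_nonpos
    (sub_nonpos.2 (hm y ⟨hy.1.le, hy.2.le.trans hx₀.2⟩)) (sub_nonpos.2 hy.2.le)

theorem deriv_deriv_nonpos_of_isLocalMax {v : ℝ → ℝ} {x₀ : ℝ} (hc : ContinuousAt v x₀)
    (hm : IsLocalMax v x₀) : deriv (deriv v) x₀ ≤ 0 := by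
  by_contra! hpos
  have hmin := isLocalMin_of_deriv_deriv_pos hpos hm.deriv_eq_zero hc
  have hconst : v =ᶠ[nhds x₀] fun _ => v x₀ := by
    filter_upwards [hm, hmin] with y h1 h2 using le_antisymm h1 h2
  have h := hconst.deriv.deriv.eq_of_nhds
  simp at h
  linarith

theorem SolvesOn.neg {ε : ℝ} {a b c f v w : ℝ → ℝ} (h : SolvesOn ε a b c f v w) :
    SolvesOn ε a b c (fun x => -f x) (fun x => -v x) (fun x => -w x) := by
  obtain ⟨hv, hw, h⟩ := h
  refine ⟨hv.neg, hw.neg, fun x hx => ?_⟩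
  have e : deriv (fun x => -v x) = fun x => -deriv v x := by ext; simp
  rw [e]
  simp only [deriv.fun_neg]
  linarith [h x hx]

theorem deriv_comb {u₀ u₁ u₂ : ℝ → ℝ} (h₀ : Differentiable ℝ u₀) (h₁ : Differentiable ℝ u₁)
    (h₂ : Differentiable ℝ u₂) (c₀ c₁ c₂ : ℝ) :
    deriv (fun x => c₀ * u₀ x + c₁ * u₁ x + c₂ * u₂ x) =
      fun x => c₀ * deriv u₀ x + c₁ * deriv u₁ x + c₂ * deriv u₂ x := by
  ext x
  exact ((((h₀ x).hasDerivAt.const_mul c₀).add ((h₁ x).hasDerivAt.const_mul c₁)).add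
    ((h₂ x).hasDerivAt.const_mul c₂)).deriv

theorem deriv_deriv_comb {u₀ u₁ u₂ : ℝ → ℝ} (h₀ : ContDiff ℝ 3 u₀) (h₁ : ContDiff ℝ 3 u₁)
    (h₂ : ContDiff ℝ 3 u₂) (c₀ c₁ c₂ : ℝ) :
    deriv (deriv (fun x => c₀ * u₀ x + c₁ * u₁ x + c₂ * u₂ x)) =
      fun x => c₀ * deriv (deriv u₀) x + c₁ * deriv (deriv u₁) x + c₂ * deriv (deriv u₂) x := by
  obtain ⟨d₀, d₀', -⟩ := h₀.regularity_three
  obtain ⟨d₁, d₁', -⟩ := h₁.regularity_three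
  obtain ⟨d₂, d₂', -⟩ := h₂.regularity_three
  rw [deriv_comb d₀ d₁ d₂, deriv_comb d₀' d₁' d₂']

theorem SolvesOn.comb {ε : ℝ} {a b c f u₀ u₁ u₂ w₀ w₁ w₂ : ℝ → ℝ}
    (h₀ : SolvesOn ε a b c f u₀ w₀) (h₁ : SolvesOn ε a b c f u₁ w₁)
    (h₂ : SolvesOn ε a b c f u₂ w₂) (c₀ c₁ c₂ : ℝ) :
    SolvesOn ε a b c (fun x => (c₀ + c₁ + c₂) * f x)
      (fun x => c₀ * u₀ x + c₁ * u₁ x + c₂ * u₂ x)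
      (fun x => c₀ * w₀ x + c₁ * w₁ x + c₂ * w₂ x) := by
  obtain ⟨hu₀, hw₀, e₀⟩ := h₀
  obtain ⟨hu₁, hw₁, e₁⟩ := h₁
  obtain ⟨hu₂, hw₂, e₂⟩ := h₂
  refine ⟨by fun_prop, by fun_prop, fun x hx => ?_⟩
  rw [deriv_deriv_comb hu₀ hu₁ hu₂, deriv_comb hu₀.regularity_three.1 hu₁.regularity_three.1
    hu₂.regularity_three.1]
  linear_combination c₀ * e₀ x hx + c₁ * e₁ x hx + c₂ * e₂ x hx

/-- Bound at a point where `v` attains the largest modulus of the pair `(v, w)`. -/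
theorem SolvesOn.le_of_isMaxOn {ε β K F x₀ : ℝ} {a b c f v w : ℝ → ℝ}
    (h : SolvesOn ε a b c f v w) (hε : 0 < ε) (hβ : 0 < β)
    (ha : ∀ x ∈ Icc (0:ℝ) 1, 0 ≤ a x) (hb : ∀ x ∈ Icc (0:ℝ) 1, β ≤ b x - c x)
    (hc : ∀ x ∈ Icc (0:ℝ) 1, 0 ≤ c x) (hf : ∀ x ∈ Icc (0:ℝ) 1, |f x| ≤ F) (hF : F ≤ β * K)
    (h1 : v 1 ≤ K) (h0 : v 0 ≤ K ∨ deriv (deriv v) 0 = 0)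
    (hx₀ : x₀ ∈ Icc (0:ℝ) 1) (hv : ∀ x ∈ Icc (0:ℝ) 1, v x ≤ v x₀)
    (hw : ∀ x ∈ Icc (0:ℝ) 1, |w x| ≤ v x₀) : v x₀ ≤ K := by
  obtain ⟨hvs, -, e⟩ := h
  have hd := hvs.regularity_three.1
  have hM : 0 ≤ v x₀ := (abs_nonneg _).trans (hw x₀ hx₀)
  have key : deriv (deriv v) x₀ ≤ 0 → deriv v x₀ ≤ 0 → v x₀ ≤ K := by
    intro h2 h3
    have e0 := e x₀ hx₀
    have i1 : ε * deriv (deriv v) x₀ ≤ 0 := mul_nonpos_of_nonneg_of_nonpos hε.le h2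
    have i2 : a x₀ * deriv v x₀ ≤ 0 := mul_nonpos_of_nonneg_of_nonpos (ha _ hx₀) h3
    have i3 : c x₀ * w x₀ ≤ c x₀ * v x₀ :=
      mul_le_mul_of_nonneg_left ((le_abs_self _).trans (hw x₀ hx₀)) (hc _ hx₀)
    have i4 : β * v x₀ ≤ (b x₀ - c x₀) * v x₀ := mul_le_mul_of_nonneg_right (hb _ hx₀) hM
    have i5 := (abs_le.1 (hf x₀ hx₀)).1
    refine le_of_mul_le_mul_left ?_ hβ
    nlinarith
  rcases hx₀.2.eq_or_lt with hr | hr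
  · rwa [hr]
  have hn := deriv_nonpos_of_isMaxOn (hd x₀) hx₀ hr hv
  rcases hx₀.1.eq_or_lt with hl | hl
  · subst hl
    rcases h0 with h0 | h0
    · exact h0
    · exact key h0.le hn
  · refine key (deriv_deriv_nonpos_of_isLocalMax hd.continuous.continuousAt ?_) hn
    filter_upwards [Icc_mem_nhds hl hr] with y hy using hv y hy

theorem SolvesOn.abs_le_of_isMaxOn {ε β K F x₀ : ℝ} {a b c f v w : ℝ → ℝ}
    (h : SolvesOn ε a b c f v w) (hε : 0 < ε) (hβ : 0 < β)
    (ha : ∀ x ∈ Icc (0:ℝ) 1, 0 ≤ a x) (hb : ∀ x ∈ Icc (0:ℝ) 1, β ≤ b x - c x)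
    (hc : ∀ x ∈ Icc (0:ℝ) 1, 0 ≤ c x) (hf : ∀ x ∈ Icc (0:ℝ) 1, |f x| ≤ F) (hF : F ≤ β * K)
    (h1 : |v 1| ≤ K) (h0 : |v 0| ≤ K ∨ deriv (deriv v) 0 = 0)
    (hx₀ : x₀ ∈ Icc (0:ℝ) 1) (hv : ∀ x ∈ Icc (0:ℝ) 1, |v x| ≤ |v x₀|)
    (hw : ∀ x ∈ Icc (0:ℝ) 1, |w x| ≤ |v x₀|) : |v x₀| ≤ K := by
  rcases abs_cases (v x₀) with ⟨hs, -⟩ | ⟨hs, -⟩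
  · rw [hs] at hv hw ⊢
    exact h.le_of_isMaxOn hε hβ ha hb hc hf hF ((le_abs_self _).trans h1)
      (h0.imp_left (le_abs_self _).trans) hx₀ (fun x hx => (le_abs_self _).trans (hv x hx)) hw
  · rw [hs] at hv hw ⊢
    refine h.neg.le_of_isMaxOn (x₀ := x₀) hε hβ ha hb hc (by simpa using hf) hF
      ((neg_le_abs _).trans h1) (h0.imp (neg_le_abs _).trans fun h => ?_) hx₀
      (fun x hx => (neg_le_abs _).trans (hv x hx)) (by simpa using hw)
    have e : deriv (fun x => -v x) = fun x => -deriv v x := by ext; simp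
    rw [e]
    simpa using h

/-- Maximum principle for the coupled system; at `0` either the values are bounded or the second
derivatives vanish. -/
theorem SolvesOn.abs_le {ε₁ ε₂ β K F : ℝ} {a₁ a₂ b₁₁ b₁₂ b₂₁ b₂₂ f₁ f₂ v₁ v₂ : ℝ → ℝ}
    (h₁ : SolvesOn ε₁ a₁ b₁₁ b₁₂ f₁ v₁ v₂) (h₂ : SolvesOn ε₂ a₂ b₂₂ b₂₁ f₂ v₂ v₁)
    (hε₁ : 0 < ε₁) (hε₂ : 0 < ε₂) (hβ : 0 < β)
    (ha₁ : ∀ x ∈ Icc (0:ℝ) 1, 0 ≤ a₁ x) (ha₂ : ∀ x ∈ Icc (0:ℝ) 1, 0 ≤ a₂ x)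
    (hb₁ : ∀ x ∈ Icc (0:ℝ) 1, β ≤ b₁₁ x - b₁₂ x)
    (hb₂ : ∀ x ∈ Icc (0:ℝ) 1, β ≤ b₂₂ x - b₂₁ x)
    (hb₁₂ : ∀ x ∈ Icc (0:ℝ) 1, 0 ≤ b₁₂ x) (hb₂₁ : ∀ x ∈ Icc (0:ℝ) 1, 0 ≤ b₂₁ x)
    (hf₁ : ∀ x ∈ Icc (0:ℝ) 1, |f₁ x| ≤ F) (hf₂ : ∀ x ∈ Icc (0:ℝ) 1, |f₂ x| ≤ F)
    (hF : F ≤ β * K) (hr₁ : |v₁ 1| ≤ K) (hr₂ : |v₂ 1| ≤ K)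
    (hl₁ : |v₁ 0| ≤ K ∨ deriv (deriv v₁) 0 = 0) (hl₂ : |v₂ 0| ≤ K ∨ deriv (deriv v₂) 0 = 0) :
    ∀ x ∈ Icc (0:ℝ) 1, |v₁ x| ≤ K ∧ |v₂ x| ≤ K := by
  have ne : (Icc (0:ℝ) 1).Nonempty := ⟨0, by simp⟩
  obtain ⟨y, hy, hym⟩ := isCompact_Icc.exists_isMaxOn ne h₁.1.continuous.abs.continuousOn
  obtain ⟨z, hz, hzm⟩ := isCompact_Icc.exists_isMaxOn ne h₂.1.continuous.abs.continuousOn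
  have hym' : ∀ x ∈ Icc (0:ℝ) 1, |v₁ x| ≤ |v₁ y| := fun x hx => hym hx
  have hzm' : ∀ x ∈ Icc (0:ℝ) 1, |v₂ x| ≤ |v₂ z| := fun x hx => hzm hx
  rcases le_total |v₂ z| |v₁ y| with hle | hle
  · have := h₁.abs_le_of_isMaxOn hε₁ hβ ha₁ hb₁ hb₁₂ hf₁ hF hr₁ hl₁ hy hym'
      (fun x hx => (hzm' x hx).trans hle)
    exact fun x hx => ⟨(hym' x hx).trans this, (hzm' x hx).trans (hle.trans this)⟩
  · have := h₂.abs_le_of_isMaxOn hε₂ hβ ha₂ hb₂ hb₂₁ hf₂ hF hr₂ hl₂ hz hzm'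
      (fun x hx => (hym' x hx).trans hle)
    exact fun x hx => ⟨(hym' x hx).trans (hle.trans this), (hzm' x hx).trans this⟩

theorem le_of_first_order {ε α G : ℝ} {a g p : ℝ → ℝ} (hε : 0 < ε) (hα : 0 < α) (hG : 0 ≤ G)
    (hp : Differentiable ℝ p) (ha : ∀ x ∈ Icc (0:ℝ) 1, α ≤ a x)
    (e : ∀ x ∈ Icc (0:ℝ) 1, ε * deriv p x + a x * p x = g x)
    (hg : ∀ x ∈ Icc (0:ℝ) 1, g x ≤ α * G) (h0 : p 0 ≤ G) :
    ∀ x ∈ Icc (0:ℝ) 1, p x ≤ G := by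
  obtain ⟨y, hy, hym⟩ := isCompact_Icc.exists_isMaxOn (⟨0, by simp⟩ : (Icc (0:ℝ) 1).Nonempty)
    hp.continuous.continuousOn
  have hm : ∀ x ∈ Icc (0:ℝ) 1, p x ≤ p y := fun x hx => hym hx
  suffices p y ≤ G from fun x hx => (hm x hx).trans this
  rcases hy.1.eq_or_lt with hl | hl
  · rwa [← hl]
  by_contra! hlt
  have hd := mul_nonneg hε.le (deriv_nonneg_of_isMaxOn (hp y) hy hl hm)
  have h1 : α * p y ≤ a y * p y := mul_le_mul_of_nonneg_right (ha y hy) (hG.trans hlt.le)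
  have h2 : α * G < α * p y := mul_lt_mul_of_pos_left hlt hα
  linarith [e y hy, hg y hy]

/-- Uniform bound for the singularly perturbed first-order equation. -/
theorem abs_le_of_first_order {ε α G : ℝ} {a g p : ℝ → ℝ} (hε : 0 < ε) (hα : 0 < α)
    (hp : Differentiable ℝ p) (ha : ∀ x ∈ Icc (0:ℝ) 1, α ≤ a x)
    (e : ∀ x ∈ Icc (0:ℝ) 1, ε * deriv p x + a x * p x = g x)
    (hg : ∀ x ∈ Icc (0:ℝ) 1, |g x| ≤ α * G) (h0 : |p 0| ≤ G) :
    ∀ x ∈ Icc (0:ℝ) 1, |p x| ≤ G := by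
  have hG : 0 ≤ G := (abs_nonneg _).trans h0
  intro x hx
  refine _root_.abs_le'.2 ⟨le_of_first_order hε hα hG hp ha e
    (fun x hx => (le_abs_self _).trans (hg x hx)) ((le_abs_self _).trans h0) x hx, ?_⟩
  refine le_of_first_order (p := fun x => -p x) (g := fun x => -g x) hε hα hG hp.neg ha ?_
    (fun x hx => (neg_le_abs _).trans (hg x hx)) ((neg_le_abs _).trans h0) x hx
  intro x hx
  simp only [deriv.fun_neg]
  linarith [e x hx]

theorem abs_mul_le_mul {x y A B : ℝ} (hx : |x| ≤ A) (hy : |y| ≤ B) : |x * y| ≤ A * B := by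
  rw [abs_mul]
  exact mul_le_mul hx hy (abs_nonneg _) ((abs_nonneg _).trans hx)

theorem SolvesOn.abs_deriv_le {ε α A K G : ℝ} {a b c f v w : ℝ → ℝ}
    (h : SolvesOn ε a b c f v w) (hε : 0 < ε) (hα : 0 < α)
    (ha : ∀ x ∈ Icc (0:ℝ) 1, α ≤ a x)
    (hb : ∀ x ∈ Icc (0:ℝ) 1, |b x| ≤ A) (hc : ∀ x ∈ Icc (0:ℝ) 1, |c x| ≤ A)
    (hf : ∀ x ∈ Icc (0:ℝ) 1, |f x| ≤ A)
    (hv : ∀ x ∈ Icc (0:ℝ) 1, |v x| ≤ K) (hw : ∀ x ∈ Icc (0:ℝ) 1, |w x| ≤ K)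
    (hG : A + 2 * (A * K) ≤ α * G) (h0 : deriv (deriv v) 0 = 0) :
    ∀ x ∈ Icc (0:ℝ) 1, |deriv v x| ≤ G := by
  obtain ⟨hvs, -, e⟩ := h
  have z : (0:ℝ) ∈ Icc (0:ℝ) 1 := by simp
  have hg : ∀ x ∈ Icc (0:ℝ) 1, |f x + b x * v x - c x * w x| ≤ α * G := by
    intro x hx
    have i1 := _root_.abs_le.1 (hf x hx)
    have i2 := _root_.abs_le.1 (abs_mul_le_mul (hb x hx) (hv x hx))
    have i3 := _root_.abs_le.1 (abs_mul_le_mul (hc x hx) (hw x hx))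
    exact _root_.abs_le.2 ⟨by linarith, by linarith⟩
  refine abs_le_of_first_order hε hα hvs.regularity_three.2.1 ha
    (g := fun x => f x + b x * v x - c x * w x) (fun x hx => by linarith [e x hx]) hg ?_
  have e0 : a 0 * deriv v 0 = f 0 + b 0 * v 0 - c 0 * w 0 := by
    have := e 0 z
    rw [h0] at this
    linarith
  have h3 := hg 0 z
  rw [← e0, abs_mul] at h3
  refine le_of_mul_le_mul_left (le_trans ?_ h3) hα
  exact mul_le_mul_of_nonneg_right ((ha 0 z).trans (le_abs_self _)) (abs_nonneg _)

theorem SolvesOn.deriv_eq {ε : ℝ} {a b c f v w : ℝ → ℝ} (h : SolvesOn ε a b c f v w)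
    (ha : ContDiff ℝ 4 a) (hb : ContDiff ℝ 4 b) (hc : ContDiff ℝ 4 c) (hf : ContDiff ℝ 4 f) :
    ∀ x ∈ Icc (0:ℝ) 1, ε * deriv (deriv (deriv v)) x + a x * deriv (deriv v) x =
      deriv f x - deriv a x * deriv v x + (deriv b x * v x + b x * deriv v x) -
        (deriv c x * w x + c x * deriv w x) := by
  obtain ⟨hvs, hws, e⟩ := h
  obtain ⟨v0, v1, v2, v3⟩ := hvs.regularity_three
  obtain ⟨w0, w1, -⟩ := hws.regularity_three
  have ha' := ha.continuous_deriv (by norm_num)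
  have hb' := hb.continuous_deriv (by norm_num)
  have hc' := hc.continuous_deriv (by norm_num)
  have hf' := hf.continuous_deriv (by norm_num)
  have v0' := v0.continuous
  have v1' := v1.continuous
  have v2' := v2.continuous
  have w0' := w0.continuous
  have w1' := w1.continuous
  have ha0 := ha.continuous
  have hb0 := hb.continuous
  have hc0 := hc.continuous
  refine eqOn_Icc_of_eqOn_Ioo (by fun_prop) (by fun_prop) fun x hx => ?_
  have da := (ha.differentiable (by norm_num) x).hasDerivAt
  have db := (hb.differentiable (by norm_num) x).hasDerivAt
  have dc := (hc.differentiable (by norm_num) x).hasDerivAt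
  have df := (hf.differentiable (by norm_num) x).hasDerivAt
  have dl := ((((v2 x).hasDerivAt.const_mul ε).add (da.mul (v1 x).hasDerivAt)).sub
    (db.mul (v0 x).hasDerivAt)).add (dc.mul (w0 x).hasDerivAt)
  have hee : (fun y => ε * deriv (deriv v) y + a y * deriv v y - b y * v y + c y * w y)
      =ᶠ[nhds x] f := by
    filter_upwards [Icc_mem_nhds hx.1 hx.2] with y hy using e y hy
  have := dl.unique (df.congr_of_eventuallyEq hee)
  linarith

theorem SolvesOn.abs_higher_deriv_le {ε α A K G H : ℝ} {a b c f v w : ℝ → ℝ}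
    (h : SolvesOn ε a b c f v w) (hε : 0 < ε) (hα : 0 < α)
    (has : ContDiff ℝ 4 a) (hbs : ContDiff ℝ 4 b) (hcs : ContDiff ℝ 4 c) (hfs : ContDiff ℝ 4 f)
    (ha : ∀ x ∈ Icc (0:ℝ) 1, α ≤ a x) (hA : ∀ x ∈ Icc (0:ℝ) 1, |a x| ≤ A)
    (hb : ∀ x ∈ Icc (0:ℝ) 1, |b x| ≤ A) (hc : ∀ x ∈ Icc (0:ℝ) 1, |c x| ≤ A)
    (ha' : ∀ x ∈ Icc (0:ℝ) 1, |deriv a x| ≤ A) (hb' : ∀ x ∈ Icc (0:ℝ) 1, |deriv b x| ≤ A)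
    (hc' : ∀ x ∈ Icc (0:ℝ) 1, |deriv c x| ≤ A) (hf' : ∀ x ∈ Icc (0:ℝ) 1, |deriv f x| ≤ A)
    (hv : ∀ x ∈ Icc (0:ℝ) 1, |v x| ≤ K) (hw : ∀ x ∈ Icc (0:ℝ) 1, |w x| ≤ K)
    (hv' : ∀ x ∈ Icc (0:ℝ) 1, |deriv v x| ≤ G) (hw' : ∀ x ∈ Icc (0:ℝ) 1, |deriv w x| ≤ G)
    (hH : A + 3 * (A * G) + 2 * (A * K) ≤ α * H) (hH0 : 0 ≤ H) (h0 : deriv (deriv v) 0 = 0) :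
    ∀ x ∈ Icc (0:ℝ) 1, |deriv (deriv v) x| ≤ H ∧
      |deriv (deriv (deriv v)) x| ≤ (A * H + α * H) / ε := by
  have e := h.deriv_eq has hbs hcs hfs
  have hg : ∀ x ∈ Icc (0:ℝ) 1, |deriv f x - deriv a x * deriv v x +
      (deriv b x * v x + b x * deriv v x) - (deriv c x * w x + c x * deriv w x)| ≤ α * H := by
    intro x hx
    have i1 := _root_.abs_le.1 (hf' x hx)
    have i2 := _root_.abs_le.1 (abs_mul_le_mul (ha' x hx) (hv' x hx))
    have i3 := _root_.abs_le.1 (abs_mul_le_mul (hb' x hx) (hv x hx))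
    have i4 := _root_.abs_le.1 (abs_mul_le_mul (hb x hx) (hv' x hx))
    have i5 := _root_.abs_le.1 (abs_mul_le_mul (hc' x hx) (hw x hx))
    have i6 := _root_.abs_le.1 (abs_mul_le_mul (hc x hx) (hw' x hx))
    exact _root_.abs_le.2 ⟨by linarith, by linarith⟩
  have h2 := abs_le_of_first_order hε hα h.1.regularity_three.2.2.1 ha e hg
    (by rw [h0]; simpa using hH0)
  refine fun x hx => ⟨h2 x hx, ?_⟩
  rw [le_div_iff₀ hε, mul_comm, show ε * |deriv (deriv (deriv v)) x| =
    |ε * deriv (deriv (deriv v)) x| by rw [abs_mul, abs_of_pos hε]]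
  have i1 := _root_.abs_le.1 (abs_mul_le_mul (hA x hx) (h2 x hx))
  have i2 := _root_.abs_le.1 (hg x hx)
  have i3 := e x hx
  exact _root_.abs_le.2 ⟨by linarith, by linarith⟩

theorem exists_abs_bound {f : ℝ → ℝ} (hf : ContDiff ℝ 4 f) :
    ∃ A, 0 ≤ A ∧ ∀ x ∈ Icc (0:ℝ) 1, |f x| ≤ A ∧ |deriv f x| ≤ A := by
  obtain ⟨B, hB⟩ := isCompact_Icc.exists_bound_of_continuousOn (s := Icc (0:ℝ) 1)
    hf.continuous.continuousOn
  obtain ⟨D, hD⟩ := isCompact_Icc.exists_bound_of_continuousOn (s := Icc (0:ℝ) 1)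
    (hf.continuous_deriv (by norm_num)).continuousOn
  exact ⟨max 0 (max B D), le_max_left _ _, fun x hx =>
    ⟨(hB x hx).trans (by simp), (hD x hx).trans (by simp)⟩⟩

/-- If the system is solvable for the boundary values `(0,0)`, `(1,0)`, `(0,1)` at `0`, then it has
a solution whose second derivatives vanish at `0`. -/
theorem exists_solution_deriv_deriv_eq_zero {ε₁ ε₂ β r₁ r₂ : ℝ}
    {a₁ a₂ b₁₁ b₁₂ b₂₁ b₂₂ f₁ f₂ : ℝ → ℝ} (hε₁ : 0 < ε₁) (hε₂ : 0 < ε₂) (hβ : 0 < β)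
    (ha₁ : ∀ x ∈ Icc (0:ℝ) 1, 0 ≤ a₁ x) (ha₂ : ∀ x ∈ Icc (0:ℝ) 1, 0 ≤ a₂ x)
    (hb₁ : ∀ x ∈ Icc (0:ℝ) 1, β ≤ b₁₁ x - b₁₂ x)
    (hb₂ : ∀ x ∈ Icc (0:ℝ) 1, β ≤ b₂₂ x - b₂₁ x)
    (hb₁₂ : ∀ x ∈ Icc (0:ℝ) 1, 0 ≤ b₁₂ x) (hb₂₁ : ∀ x ∈ Icc (0:ℝ) 1, 0 ≤ b₂₁ x)
    (hex : ∀ s t : ℝ, |s| ≤ 1 → |t| ≤ 1 → ∃ v₁ v₂, SolvesOn ε₁ a₁ b₁₁ b₁₂ f₁ v₁ v₂ ∧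
      SolvesOn ε₂ a₂ b₂₂ b₂₁ f₂ v₂ v₁ ∧ v₁ 0 = s ∧ v₂ 0 = t ∧ v₁ 1 = r₁ ∧ v₂ 1 = r₂) :
    ∃ v₁ v₂, SolvesOn ε₁ a₁ b₁₁ b₁₂ f₁ v₁ v₂ ∧ SolvesOn ε₂ a₂ b₂₂ b₂₁ f₂ v₂ v₁ ∧
      v₁ 1 = r₁ ∧ v₂ 1 = r₂ ∧ deriv (deriv v₁) 0 = 0 ∧ deriv (deriv v₂) 0 = 0 := by
  obtain ⟨p₀, q₀, hp₀, hq₀, pl₀, ql₀, pr₀, qr₀⟩ := hex 0 0 (by simp) (by simp)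
  obtain ⟨p₁, q₁, hp₁, hq₁, pl₁, ql₁, pr₁, qr₁⟩ := hex 1 0 (by simp) (by simp)
  obtain ⟨p₂, q₂, hp₂, hq₂, pl₂, ql₂, pr₂, qr₂⟩ := hex 0 1 (by simp) (by simp)
  have dp := deriv_deriv_comb hp₀.1 hp₁.1 hp₂.1
  have dq := deriv_deriv_comb hq₀.1 hq₁.1 hq₂.1
  let M : Matrix (Fin 2) (Fin 2) ℝ :=
    !![deriv (deriv p₁) 0 - deriv (deriv p₀) 0, deriv (deriv p₂) 0 - deriv (deriv p₀) 0;
      deriv (deriv q₁) 0 - deriv (deriv q₀) 0, deriv (deriv q₂) 0 - deriv (deriv q₀) 0]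
  have hinj : Function.Injective M.mulVecLin := by
    rw [injective_iff_map_eq_zero]
    intro c hc
    have hc0 := congrFun hc 0
    have hc1 := congrFun hc 1
    simp [M, Matrix.mulVec, dotProduct, Fin.sum_univ_two] at hc0 hc1
    have hz := (hp₀.comb hp₁ hp₂ (-c 0 - c 1) (c 0) (c 1)).abs_le
      (hq₀.comb hq₁ hq₂ (-c 0 - c 1) (c 0) (c 1)) (K := 0) (F := 0) hε₁ hε₂ hβ ha₁ ha₂ hb₁ hb₂
      hb₁₂ hb₂₁ (fun x _ => le_of_eq (by rw [abs_eq_zero]; ring))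
      (fun x _ => le_of_eq (by rw [abs_eq_zero]; ring)) (by simp)
      (le_of_eq (by rw [abs_eq_zero, pr₀, pr₁, pr₂]; ring))
      (le_of_eq (by rw [abs_eq_zero, qr₀, qr₁, qr₂]; ring))
      (Or.inr (by rw [dp]; linear_combination hc0)) (Or.inr (by rw [dq]; linear_combination hc1))
      0 (by simp)
    simp only [pl₀, pl₁, pl₂, ql₀, ql₁, ql₂] at hz
    ext i
    fin_cases i
    · simpa using hz.1
    · simpa using hz.2
  obtain ⟨c, hc⟩ := (LinearMap.injective_iff_surjective.1 hinj)
    ![-deriv (deriv p₀) 0, -deriv (deriv q₀) 0]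
  have hc0 := congrFun hc 0
  have hc1 := congrFun hc 1
  simp [M, Matrix.mulVec, dotProduct, Fin.sum_univ_two] at hc0 hc1
  have h1 := hp₀.comb hp₁ hp₂ (1 - c 0 - c 1) (c 0) (c 1)
  have h2 := hq₀.comb hq₁ hq₂ (1 - c 0 - c 1) (c 0) (c 1)
  have hs : 1 - c 0 - c 1 + c 0 + c 1 = 1 := by ring
  simp only [hs, one_mul] at h1 h2
  refine ⟨_, _, h1, h2, ?_, ?_, ?_, ?_⟩
  · rw [pr₀, pr₁, pr₂]; ring
  · rw [qr₀, qr₁, qr₂]; ring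
  · rw [dp]; linear_combination hc0
  · rw [dq]; linear_combination hc1

theorem deriv_deriv_eq_of_eqOn {u v : ℝ → ℝ} (hu : ContDiff ℝ 3 u) (hv : ContDiff ℝ 3 v)
    (h : ∀ x ∈ Icc (0:ℝ) 1, u x = v x) :
    ∀ x ∈ Icc (0:ℝ) 1, deriv (deriv u) x = deriv (deriv v) x := by
  refine eqOn_Icc_of_eqOn_Ioo hu.regularity_three.2.2.1.continuous
    hv.regularity_three.2.2.1.continuous fun x hx => ?_
  have : u =ᶠ[nhds x] v := by
    filter_upwards [Icc_mem_nhds hx.1 hx.2] with y hy using h y hy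
  exact this.deriv.deriv.eq_of_nhds

theorem SolvesOn.of_Ioo {ε : ℝ} {a b c f v w : ℝ → ℝ} (ha : Continuous a) (hb : Continuous b)
    (hc : Continuous c) (hf : Continuous f) (hv : ContDiff ℝ 3 v) (hw : ContDiff ℝ 3 w)
    (h : ∀ x ∈ Ioo (0:ℝ) 1,
      ε * deriv (deriv v) x + a x * deriv v x - b x * v x + c x * w x = f x) :
    SolvesOn ε a b c f v w := by
  have h0 := hv.continuous
  have h1 := hv.regularity_three.2.1.continuous
  have h2 := hv.regularity_three.2.2.1.continuous
  have h3 := hw.continuous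
  exact ⟨hv, hw, eqOn_Icc_of_eqOn_Ioo (by fun_prop) hf h⟩

/-- Estimates for the smooth component: there is a suitable choice of the boundary
value v(0), bounded independently of ε₁ and ε₂, such that the smooth component and
its derivatives satisfy parameter-uniform bounds. -/
theorem smooth_component_estimates
    (α β : ℝ) (a₁ a₂ b₁₁ b₁₂ b₂₁ b₂₂ f₁ f₂ : ℝ → ℝ) (r₁ r₂ : ℝ)
    (hα : 0 < α) (hβ : 0 < β)
    (ha₁s : ContDiff ℝ 4 a₁) (ha₂s : ContDiff ℝ 4 a₂)
    (hb₁₁s : ContDiff ℝ 4 b₁₁) (hb₁₂s : ContDiff ℝ 4 b₁₂)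
    (hb₂₁s : ContDiff ℝ 4 b₂₁) (hb₂₂s : ContDiff ℝ 4 b₂₂)
    (hf₁s : ContDiff ℝ 4 f₁) (hf₂s : ContDiff ℝ 4 f₂)
    (ha₁ : ∀ x ∈ Icc (0:ℝ) 1, α ≤ a₁ x) (ha₂ : ∀ x ∈ Icc (0:ℝ) 1, α ≤ a₂ x)
    (hb₁ : ∀ x ∈ Icc (0:ℝ) 1, β ≤ b₁₁ x - b₁₂ x)
    (hb₂ : ∀ x ∈ Icc (0:ℝ) 1, β ≤ b₂₂ x - b₂₁ x)
    (hb₁₂ : ∀ x ∈ Icc (0:ℝ) 1, 0 < b₁₂ x) (hb₂₁ : ∀ x ∈ Icc (0:ℝ) 1, 0 < b₂₁ x) :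
    ∃ C : ℝ, 0 < C ∧
      ∀ ε₁ ε₂ : ℝ, 0 < ε₁ → ε₁ < ε₂ → ε₂ ≤ 1 →
      ∃ v0₁ v0₂ : ℝ, |v0₁| ≤ C ∧ |v0₂| ≤ C ∧
        ∀ v₁ v₂ : ℝ → ℝ, ContDiff ℝ 3 v₁ → ContDiff ℝ 3 v₂ →
          (∀ x ∈ Ioo (0:ℝ) 1,
            ε₁ * deriv (deriv v₁) x + a₁ x * deriv v₁ x - b₁₁ x * v₁ x + b₁₂ x * v₂ x
              = f₁ x ∧
            ε₂ * deriv (deriv v₂) x + a₂ x * deriv v₂ x - b₂₂ x * v₂ x + b₂₁ x * v₁ x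
              = f₂ x) →
          v₁ 0 = v0₁ → v₂ 0 = v0₂ → v₁ 1 = r₁ → v₂ 1 = r₂ →
          ∀ x ∈ Icc (0:ℝ) 1,
            (∀ k ≤ 2, |iteratedDeriv k v₁ x| ≤ C ∧ |iteratedDeriv k v₂ x| ≤ C) ∧
            |iteratedDeriv 3 v₁ x| ≤ C / ε₁ ∧ |iteratedDeriv 3 v₂ x| ≤ C / ε₂ := by
  obtain ⟨A₁, pA₁, A₁h⟩ := exists_abs_bound ha₁s
  obtain ⟨A₂, pA₂, A₂h⟩ := exists_abs_bound ha₂s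
  obtain ⟨A₃, pA₃, A₃h⟩ := exists_abs_bound hb₁₁s
  obtain ⟨A₄, pA₄, A₄h⟩ := exists_abs_bound hb₁₂s
  obtain ⟨A₅, pA₅, A₅h⟩ := exists_abs_bound hb₂₁s
  obtain ⟨A₆, pA₆, A₆h⟩ := exists_abs_bound hb₂₂s
  obtain ⟨A₇, pA₇, A₇h⟩ := exists_abs_bound hf₁s
  obtain ⟨A₈, pA₈, A₈h⟩ := exists_abs_bound hf₂s
  obtain ⟨A, hA⟩ : ∃ A, A = A₁ + A₂ + A₃ + A₄ + A₅ + A₆ + A₇ + A₈ := ⟨_, rfl⟩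
  have up : ∀ {g : ℝ → ℝ} {B : ℝ}, B ≤ A →
      (∀ x ∈ Icc (0:ℝ) 1, |g x| ≤ B ∧ |deriv g x| ≤ B) →
      (∀ x ∈ Icc (0:ℝ) 1, |g x| ≤ A) ∧ ∀ x ∈ Icc (0:ℝ) 1, |deriv g x| ≤ A :=
    fun hB h => ⟨fun x hx => (h x hx).1.trans hB, fun x hx => (h x hx).2.trans hB⟩
  obtain ⟨Ba₁, Ba₁'⟩ := up (by linarith) A₁h
  obtain ⟨Ba₂, Ba₂'⟩ := up (by linarith) A₂h
  obtain ⟨Bb₁₁, Bb₁₁'⟩ := up (by linarith) A₃h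
  obtain ⟨Bb₁₂, Bb₁₂'⟩ := up (by linarith) A₄h
  obtain ⟨Bb₂₁, Bb₂₁'⟩ := up (by linarith) A₅h
  obtain ⟨Bb₂₂, Bb₂₂'⟩ := up (by linarith) A₆h
  obtain ⟨Bf₁, Bf₁'⟩ := up (by linarith) A₇h
  obtain ⟨Bf₂, Bf₂'⟩ := up (by linarith) A₈h
  have A0 : 0 ≤ A := by linarith
  obtain ⟨K, hK⟩ : ∃ K, K = |r₁| + |r₂| + A / β := ⟨_, rfl⟩
  have Aβ : 0 ≤ A / β := by positivity
  have K0 : 0 ≤ K := by rw [hK]; positivity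
  have hKr₁ : |r₁| ≤ K := by linarith [abs_nonneg r₂]
  have hKr₂ : |r₂| ≤ K := by linarith [abs_nonneg r₁]
  have hKA : A ≤ β * K := by
    have h1 : β * (A / β) = A := by field_simp
    have h2 : β * (A / β) ≤ β * K :=
      mul_le_mul_of_nonneg_left (by linarith [abs_nonneg r₁, abs_nonneg r₂]) hβ.le
    linarith
  obtain ⟨G, hG⟩ : ∃ G, G = (A + 2 * (A * K)) / α := ⟨_, rfl⟩
  have G0 : 0 ≤ G := by rw [hG]; positivity
  have hG' : A + 2 * (A * K) ≤ α * G := by rw [hG]; field_simp; rfl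
  obtain ⟨H, hH⟩ : ∃ H, H = (A + 3 * (A * G) + 2 * (A * K)) / α := ⟨_, rfl⟩
  have H0 : 0 ≤ H := by rw [hH]; positivity
  have hH' : A + 3 * (A * G) + 2 * (A * K) ≤ α * H := by rw [hH]; field_simp; rfl
  have AH : 0 ≤ A * H := by positivity
  have αH : 0 ≤ α * H := by positivity
  obtain ⟨C, hC⟩ : ∃ C, C = 1 + K + G + H + (A * H + α * H) := ⟨_, rfl⟩
  have ha₁0 : ∀ x ∈ Icc (0:ℝ) 1, 0 ≤ a₁ x := fun x hx => hα.le.trans (ha₁ x hx)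
  have ha₂0 : ∀ x ∈ Icc (0:ℝ) 1, 0 ≤ a₂ x := fun x hx => hα.le.trans (ha₂ x hx)
  have hb₁₂0 : ∀ x ∈ Icc (0:ℝ) 1, 0 ≤ b₁₂ x := fun x hx => (hb₁₂ x hx).le
  have hb₂₁0 : ∀ x ∈ Icc (0:ℝ) 1, 0 ≤ b₂₁ x := fun x hx => (hb₂₁ x hx).le
  refine ⟨C, by linarith, fun ε₁ ε₂ hε₁ hlt _ => ?_⟩
  have hε₂ : 0 < ε₂ := hε₁.trans hlt
  by_cases hex : ∀ s t : ℝ, |s| ≤ 1 → |t| ≤ 1 → ∃ v₁ v₂, SolvesOn ε₁ a₁ b₁₁ b₁₂ f₁ v₁ v₂ ∧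
      SolvesOn ε₂ a₂ b₂₂ b₂₁ f₂ v₂ v₁ ∧ v₁ 0 = s ∧ v₂ 0 = t ∧ v₁ 1 = r₁ ∧ v₂ 1 = r₂
  swap
  · push Not at hex
    obtain ⟨s, t, hs, ht, hno⟩ := hex
    refine ⟨s, t, by linarith, by linarith, fun v₁ v₂ hv₁ hv₂ e l₁ l₂ h₁ h₂ => ?_⟩
    exact absurd h₂ (hno v₁ v₂
      (.of_Ioo ha₁s.continuous hb₁₁s.continuous hb₁₂s.continuous hf₁s.continuous hv₁ hv₂
        fun x hx => (e x hx).1)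
      (.of_Ioo ha₂s.continuous hb₂₂s.continuous hb₂₁s.continuous hf₂s.continuous hv₂ hv₁
        fun x hx => (e x hx).2) l₁ l₂ h₁)
  obtain ⟨u₁, u₂, su₁, su₂, ur₁, ur₂, ud₁, ud₂⟩ := exists_solution_deriv_deriv_eq_zero hε₁ hε₂ hβ
    ha₁0 ha₂0 hb₁ hb₂ hb₁₂0 hb₂₁0 hex
  have z : (0:ℝ) ∈ Icc (0:ℝ) 1 := by simp
  have bu := su₁.abs_le su₂ hε₁ hε₂ hβ ha₁0 ha₂0 hb₁ hb₂ hb₁₂0 hb₂₁0 Bf₁ Bf₂ hKA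
    (by rwa [ur₁]) (by rwa [ur₂]) (Or.inr ud₁) (Or.inr ud₂)
  refine ⟨u₁ 0, u₂ 0, by linarith [(bu 0 z).1], by linarith [(bu 0 z).2],
    fun v₁ v₂ hv₁ hv₂ e l₁ l₂ h₁ h₂ => ?_⟩
  have sv₁ : SolvesOn ε₁ a₁ b₁₁ b₁₂ f₁ v₁ v₂ :=
    .of_Ioo ha₁s.continuous hb₁₁s.continuous hb₁₂s.continuous hf₁s.continuous hv₁ hv₂
      fun x hx => (e x hx).1
  have sv₂ : SolvesOn ε₂ a₂ b₂₂ b₂₁ f₂ v₂ v₁ :=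
    .of_Ioo ha₂s.continuous hb₂₂s.continuous hb₂₁s.continuous hf₂s.continuous hv₂ hv₁
      fun x hx => (e x hx).2
  have huv := (sv₁.comb su₁ su₁ 1 (-1) 0).abs_le (sv₂.comb su₂ su₂ 1 (-1) 0) (K := 0) (F := 0)
    hε₁ hε₂ hβ ha₁0 ha₂0 hb₁ hb₂ hb₁₂0 hb₂₁0 (by simp) (by simp) (by simp)
    (by simp [h₁, ur₁]) (by simp [h₂, ur₂]) (by simp [l₁]) (by simp [l₂])
  have eq₁ : ∀ x ∈ Icc (0:ℝ) 1, v₁ x = u₁ x := fun x hx => by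
    linarith [abs_nonpos_iff.1 (huv x hx).1]
  have eq₂ : ∀ x ∈ Icc (0:ℝ) 1, v₂ x = u₂ x := fun x hx => by
    linarith [abs_nonpos_iff.1 (huv x hx).2]
  have vd₁ : deriv (deriv v₁) 0 = 0 := (deriv_deriv_eq_of_eqOn hv₁ su₁.1 eq₁ 0 z).trans ud₁
  have vd₂ : deriv (deriv v₂) 0 = 0 := (deriv_deriv_eq_of_eqOn hv₂ su₂.1 eq₂ 0 z).trans ud₂
  have bv₁ : ∀ x ∈ Icc (0:ℝ) 1, |v₁ x| ≤ K := fun x hx => by rw [eq₁ x hx]; exact (bu x hx).1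
  have bv₂ : ∀ x ∈ Icc (0:ℝ) 1, |v₂ x| ≤ K := fun x hx => by rw [eq₂ x hx]; exact (bu x hx).2
  have bd₁ := sv₁.abs_deriv_le hε₁ hα ha₁ Bb₁₁ Bb₁₂ Bf₁ bv₁ bv₂ hG' vd₁
  have bd₂ := sv₂.abs_deriv_le hε₂ hα ha₂ Bb₂₂ Bb₂₁ Bf₂ bv₂ bv₁ hG' vd₂
  have bh₁ := sv₁.abs_higher_deriv_le hε₁ hα ha₁s hb₁₁s hb₁₂s hf₁s ha₁ Ba₁ Bb₁₁ Bb₁₂ Ba₁' Bb₁₁'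
    Bb₁₂' Bf₁' bv₁ bv₂ bd₁ bd₂ hH' H0 vd₁
  have bh₂ := sv₂.abs_higher_deriv_le hε₂ hα ha₂s hb₂₂s hb₂₁s hf₂s ha₂ Ba₂ Bb₂₂ Bb₂₁ Ba₂' Bb₂₂'
    Bb₂₁' Bf₂' bv₂ bv₁ bd₂ bd₁ hH' H0 vd₂
  intro x hx
  refine ⟨fun k hk => ?_, ?_, ?_⟩
  · interval_cases k
    · simp only [iteratedDeriv_zero]
      exact ⟨by linarith [bv₁ x hx], by linarith [bv₂ x hx]⟩
    · simp only [iteratedDeriv_one]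
      exact ⟨by linarith [bd₁ x hx], by linarith [bd₂ x hx]⟩
    · simp only [iteratedDeriv_succ, iteratedDeriv_zero]
      exact ⟨by linarith [(bh₁ x hx).1], by linarith [(bh₂ x hx).1]⟩
  · simp only [iteratedDeriv_succ, iteratedDeriv_zero]
    exact (bh₁ x hx).2.trans (div_le_div_of_nonneg_right (by linarith) hε₁.le)
  · simp only [iteratedDeriv_succ, iteratedDeriv_zero]
    exact (bh₂ x hx).2.trans (div_le_div_of_nonneg_right (by linarith) hε₂.le)
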